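/- Let 0 < p₁ < p < p₂ ≤ 0.5. Then for all integers n ≥ 1 and 0 ≤ k ≤ n, |Δ_{n,k}(p)/ρ(p) − Δ_{n,k}(p₁)/ρ(p₁)| ≤ L(p₁)·(p − p₁) and |Δ_{n,k}(p)/ρ(p) − Δ_{n,k}(p₂)/ρ(p₂)| < L(p₁)·(p₂ − p), where L(p) = (1/((1 − 2pq)√(pq))) · (c₁/p + c₂ + c₃ · (1 − 2p)(1 + 2pq)/(1 − 2pq)) with c₁ = 0.516, c₂ = 0.121, c₃ = 0.271. -/

import Mathlib

/-- The standard normal distribution function Φ. -/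
noncomputable def Phi (x : ℝ) : ℝ :=
  (Real.sqrt (2 * Real.pi))⁻¹ * ∫ t in Set.Iio x, Real.exp (-t ^ 2 / 2)

/-- The left-continuous binomial distribution function
`F_{n,p}(x) = Σ_{0 ≤ i < x} C(n,i) p^i q^{n−i}`. -/
noncomputable def binomCDF (n : ℕ) (p x : ℝ) : ℝ :=
  ∑ i ∈ Finset.range (n + 1),
    if (i : ℝ) < x then (n.choose i : ℝ) * p ^ i * (1 - p) ^ (n - i) else 0

/-- `G_{n,p}(x) = Φ((x − np)/√(npq))`. -/
noncomputable def Gnp (n : ℕ) (p x : ℝ) : ℝ :=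
  Phi ((x - n * p) / Real.sqrt (n * p * (1 - p)))

/-- `Δ_{n,k}(p) = max{ |F_{n,p}(k) − G_{n,p}(k)|, |F_{n,p}(k+1) − G_{n,p}(k)| }`. -/
noncomputable def Deltank (n k : ℕ) (p : ℝ) : ℝ :=
  max |binomCDF n p k - Gnp n p k| |binomCDF n p (k + 1) - Gnp n p k|

/-- `ρ(p) = (p² + q²)/√(pq)`. -/
noncomputable def rho (p : ℝ) : ℝ :=
  (p ^ 2 + (1 - p) ^ 2) / Real.sqrt (p * (1 - p))

/-- `L(p) = (1/((1−2pq)√(pq))) (c₁/p + c₂ + c₃ (1−2p)(1+2pq)/(1−2pq))` with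
`c₁ = 0.516`, `c₂ = 0.121`, `c₃ = 0.271`. -/
noncomputable def L (p : ℝ) : ℝ :=
  (1 / ((1 - 2 * p * (1 - p)) * Real.sqrt (p * (1 - p)))) *
    (0.516 / p + 0.121 +
      0.271 * ((1 - 2 * p) * (1 + 2 * p * (1 - p)) / (1 - 2 * p * (1 - p))))

open Complex in
theorem norm_image_le_of_norm_deriv_le_boundary {f f' : ℝ → ℂ} {B B' : ℝ → ℝ}
    (hf : ∀ x, HasDerivAt f (f' x) x) (hB : ∀ x, HasDerivAt B (B' x) x) (h0 : ‖f 0‖ ≤ B 0)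
    (hle : ∀ x, 0 ≤ x → ‖f' x‖ ≤ B' x) {x : ℝ} (hx : 0 ≤ x) : ‖f x‖ ≤ B x :=
  image_norm_le_of_norm_deriv_right_le_deriv_boundary (a := 0) (b := x)
    (fun y _ => (hf y).continuousAt.continuousWithinAt)
    (fun y _ => (hf y).hasDerivWithinAt) h0 hB (fun y hy => hle y hy.1) ⟨hx, le_rfl⟩

open Complex in
theorem norm_cexp_ofReal_mul_I_taylor_two_le_of_nonneg {x : ℝ} (hx : 0 ≤ x) :
    ‖cexp (x * I) - (1 + x * I - x ^ 2 / 2)‖ ≤ x ^ 3 / 6 := by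
  have hexp : ∀ y : ℝ, HasDerivAt (fun y : ℝ => cexp (y * I)) (cexp (y * I) * I) y := fun y => by
    simpa using ((hasDerivAt_id (y : ℂ)).comp_ofReal.mul_const I).cexp
  have hid : ∀ y : ℝ, HasDerivAt (fun y : ℝ => (y : ℂ) * I) I y := fun y => by
    simpa using (hasDerivAt_id (y : ℂ)).comp_ofReal.mul_const I
  have hsq : ∀ y : ℝ, HasDerivAt (fun y : ℝ => (y : ℂ) ^ 2 / 2) (y : ℂ) y := fun y => by
    have := ((hasDerivAt_id (y : ℂ)).comp_ofReal.pow 2).div_const 2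
    simpa using this
  have h1 : ∀ y : ℝ, 0 ≤ y → ‖cexp (y * I) - 1‖ ≤ y := fun y hy =>
    norm_image_le_of_norm_deriv_le_boundary (f := fun y : ℝ => cexp (y * I) - 1) (B := fun y => y)
      (fun y => (hexp y).sub_const 1) (fun y => hasDerivAt_id y) (by simp)
      (fun y _ => by simp [norm_exp_ofReal_mul_I]) hy
  have h2 : ∀ y : ℝ, 0 ≤ y → ‖cexp (y * I) - 1 - y * I‖ ≤ y ^ 2 / 2 := fun y hy =>
    norm_image_le_of_norm_deriv_le_boundary (f := fun y : ℝ => cexp (y * I) - 1 - y * I)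
      (B := fun y => y ^ 2 / 2) (B' := fun y => y)
      (fun y => ((hexp y).sub_const 1).sub (hid y))
      (fun y => by simpa using ((hasDerivAt_id y).pow 2).div_const 2) (by simp)
      (fun y hy => by
        have : cexp (y * I) * I - I = (cexp (y * I) - 1) * I := by ring
        rw [this, norm_mul, norm_I, mul_one]
        exact h1 y hy) hy
  have h3 := norm_image_le_of_norm_deriv_le_boundary
      (f := fun y : ℝ => cexp (y * I) - 1 - y * I + y ^ 2 / 2)
      (B := fun y => y ^ 3 / 6) (B' := fun y => y ^ 2 / 2)
      (fun y => (((hexp y).sub_const 1).sub (hid y)).add (hsq y))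
      (fun y => by
        have := ((hasDerivAt_id y).pow 3).div_const 6
        refine this.congr_deriv ?_
        simp; ring) (by simp)
      (fun y hy => by
        have : cexp (y * I) * I - I + y = (cexp (y * I) - 1 - y * I) * I := by
          linear_combination (y : ℂ) * I_sq
        rw [this, norm_mul, norm_I, mul_one]
        exact h2 y hy) hx
  convert h3 using 2
  ring

open Complex in
theorem norm_cexp_ofReal_mul_I_taylor_two_le (x : ℝ) :
    ‖cexp (x * I) - (1 + x * I - x ^ 2 / 2)‖ ≤ |x| ^ 3 / 6 := by
  rcases le_total 0 x with hx | hx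
  · simpa [abs_of_nonneg hx] using norm_cexp_ofReal_mul_I_taylor_two_le_of_nonneg hx
  · have h := norm_cexp_ofReal_mul_I_taylor_two_le_of_nonneg (neg_nonneg.2 hx)
    rw [abs_of_nonpos hx, ← norm_conj]
    convert h using 2
    simp [← exp_conj, map_ofNat]

/-- The characteristic function of a centered Bernoulli variable with success probability `p`. -/
noncomputable def bernoulliChar (p t : ℝ) : ℂ :=
  (1 - p) * Complex.exp ((-p * t : ℝ) * Complex.I) + p * Complex.exp (((1 - p) * t : ℝ) * Complex.I)

open Complex in
theorem norm_bernoulliChar_le {p t : ℝ} (hp0 : 0 < p) (hp1 : p < 1) (ht : |t| ≤ Real.pi) :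
    ‖bernoulliChar p t‖ ≤ Real.exp (-(p * (1 - p) * t ^ 2 / 5)) := by
  have hcos : Real.cos t ≤ 1 - t ^ 2 / 5 := by
    have h := Real.cos_le_one_sub_mul_cos_sq ht
    have hpi : (1 : ℝ) / 5 ≤ 2 / Real.pi ^ 2 := by
      rw [div_le_div_iff₀ (by norm_num) (by positivity)]
      nlinarith [Real.pi_lt_d4, Real.pi_pos]
    nlinarith [sq_nonneg t]
  have hfac : bernoulliChar p t = cexp ((-p * t : ℝ) * I) * ((1 - p) + p * cexp (t * I)) := by
    unfold bernoulliChar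
    rw [mul_add, mul_left_comm _ (p : ℂ), ← Complex.exp_add]
    push_cast
    ring_nf
  have hsq : ‖bernoulliChar p t‖ ^ 2 = 1 - 2 * (p * (1 - p)) * (1 - Real.cos t) := by
    rw [hfac, norm_mul, norm_exp_ofReal_mul_I, one_mul, ← normSq_eq_norm_sq, normSq_apply]
    simp [exp_ofReal_mul_I_re, exp_ofReal_mul_I_im]
    linear_combination p ^ 2 * Real.sin_sq_add_cos_sq t
  have hw : 0 < p * (1 - p) := mul_pos hp0 (by linarith)
  refine le_of_sq_le_sq ?_ (Real.exp_pos _).le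
  rw [hsq, ← Real.exp_nat_mul]
  refine le_trans ?_ (Real.add_one_le_exp _)
  push_cast
  nlinarith

open Complex in
theorem norm_bernoulliChar_sub_exp_le {p t : ℝ} (hp0 : 0 < p) (hp1 : p < 1) (ht : |t| ≤ Real.pi) :
    ‖bernoulliChar p t - (Real.exp (-(p * (1 - p) * t ^ 2 / 2)) : ℝ)‖ ≤
      0.182 * (p * (1 - p)) * |t| ^ 3 := by
  set w := p * (1 - p) with hw
  have hw0 : 0 < w := mul_pos hp0 (by linarith)
  have hw1 : w ≤ 1 / 4 := by nlinarith [sq_nonneg (p - 1 / 2)]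
  have hg : ‖((Real.exp (-(w * t ^ 2 / 2)) : ℝ) : ℂ) - (1 - w * t ^ 2 / 2 : ℝ)‖
      ≤ w ^ 2 * t ^ 4 / 8 := by
    rw [← ofReal_sub, norm_real, Real.norm_eq_abs]
    have hx : 0 ≤ w * t ^ 2 / 2 := by positivity
    have h1 := Real.one_sub_le_exp_neg (w * t ^ 2 / 2)
    have h2 : Real.exp (-(w * t ^ 2 / 2)) ≤ 1 - w * t ^ 2 / 2 + (w * t ^ 2 / 2) ^ 2 / 2 := by
      have h3 := Real.quadratic_le_exp_of_nonneg hx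
      rw [Real.exp_neg, inv_le_comm₀ (Real.exp_pos _) (by nlinarith [sq_nonneg (w * t ^ 2 / 2 - 1)])]
      refine le_trans ?_ h3
      rw [inv_le_comm₀ (by nlinarith [sq_nonneg (w * t ^ 2 / 2 - 1)]) (by positivity)]
      rw [inv_le_iff_one_le_mul₀ (by positivity)]
      nlinarith [sq_nonneg ((w * t ^ 2 / 2) ^ 2)]
    rw [abs_of_nonneg (by linarith)]
    nlinarith
  have ha := norm_cexp_ofReal_mul_I_taylor_two_le (-p * t)
  have hb := norm_cexp_ofReal_mul_I_taylor_two_le ((1 - p) * t)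
  have hdec : bernoulliChar p t - (Real.exp (-(w * t ^ 2 / 2)) : ℝ) =
      ((1 - p : ℝ) : ℂ) * (cexp ((-p * t : ℝ) * I)
        - (1 + (-p * t : ℝ) * I - ((-p * t : ℝ) : ℂ) ^ 2 / 2)) +
      (p : ℝ) * (cexp (((1 - p) * t : ℝ) * I)
        - (1 + ((1 - p) * t : ℝ) * I - (((1 - p) * t : ℝ) : ℂ) ^ 2 / 2)) -
      (((Real.exp (-(w * t ^ 2 / 2)) : ℝ) : ℂ) - (1 - w * t ^ 2 / 2 : ℝ)) := by
    unfold bernoulliChar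
    rw [hw]
    push_cast
    ring
  rw [hdec]
  refine (norm_sub_le _ _).trans ?_
  refine (add_le_add (norm_add_le _ _) hg).trans ?_
  rw [norm_mul, norm_mul, norm_real, norm_real, Real.norm_of_nonneg hp0.le,
    Real.norm_of_nonneg (by linarith : (0 : ℝ) ≤ 1 - p)]
  have hA : (1 - p) * ‖cexp ((-p * t : ℝ) * I)
        - (1 + (-p * t : ℝ) * I - ((-p * t : ℝ) : ℂ) ^ 2 / 2)‖ ≤ (1 - p) * (p ^ 3 * |t| ^ 3 / 6) := by
    refine mul_le_mul_of_nonneg_left (ha.trans_eq ?_) (by linarith)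
    rw [abs_mul, abs_neg, abs_of_pos hp0, mul_pow]
  have hB : p * ‖cexp (((1 - p) * t : ℝ) * I)
        - (1 + ((1 - p) * t : ℝ) * I - (((1 - p) * t : ℝ) : ℂ) ^ 2 / 2)‖ ≤
        p * ((1 - p) ^ 3 * |t| ^ 3 / 6) := by
    refine mul_le_mul_of_nonneg_left (hb.trans_eq ?_) hp0.le
    rw [abs_mul, abs_of_pos (by linarith : 0 < 1 - p), mul_pow]
  have ht4 : w ^ 2 * t ^ 4 / 8 ≤ w ^ 2 * |t| ^ 3 * 3.1416 / 8 := by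
    have : t ^ 4 = |t| ^ 3 * |t| := by
      rw [← pow_succ, ← Even.pow_abs (by decide : Even 4)]
    rw [this]
    have := ht.trans Real.pi_lt_d4.le
    have h3 : 0 ≤ w ^ 2 * |t| ^ 3 := by positivity
    nlinarith
  refine (add_le_add (add_le_add hA hB) ht4).trans ?_
  have key : (1 - p) * p ^ 3 / 6 + p * (1 - p) ^ 3 / 6 + w ^ 2 * 3.1416 / 8 ≤ 0.182 * w := by
    have : (1 - p) * p ^ 3 / 6 + p * (1 - p) ^ 3 / 6 = w * (1 - 2 * w) / 6 := by rw [hw]; ring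
    rw [this]
    nlinarith
  have h3 : 0 ≤ |t| ^ 3 := by positivity
  nlinarith

open Complex in
theorem norm_cexp_ofReal_mul_I_sub_exp_neg_le {x v y : ℝ} (hv0 : 0 ≤ v) (hxy : x ^ 2 ≤ y ^ 2)
    (hvy : v ≤ y ^ 2) : ‖cexp (x * I) - (Real.exp (-v) : ℝ)‖ ≤ |y| := by
  set g := Real.exp (-v)
  have hg0 : 0 ≤ g := (Real.exp_pos _).le
  have hg1 : g ≤ 1 := Real.exp_le_one_iff.2 (by linarith)
  have hg2 : 1 - v ≤ g := Real.one_sub_le_exp_neg v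
  refine le_of_sq_le_sq ?_ (abs_nonneg y)
  rw [sq_abs, ← normSq_eq_norm_sq, normSq_apply]
  simp only [sub_re, exp_ofReal_mul_I_re, ofReal_re, sub_im, exp_ofReal_mul_I_im, ofReal_im]
  have hc := Real.one_sub_sq_div_two_le_cos (x := x)
  have hs := Real.sin_sq_add_cos_sq x
  have h1 : 2 * g * (1 - Real.cos x) ≤ g * y ^ 2 := by nlinarith
  have h2 : (1 - g) * (1 - g) ≤ (1 - g) * y ^ 2 :=
    mul_le_mul_of_nonneg_left (by linarith) (by linarith)
  nlinarith

theorem norm_bernoulliChar_pow_sub_exp_le {p t : ℝ} (hp0 : 0 < p) (hp1 : p < 1)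
    (ht : |t| ≤ Real.pi) (m : ℕ) :
    ‖bernoulliChar p t ^ m - (Real.exp (-(p * (1 - p) * t ^ 2 / 2)) : ℝ) ^ m‖ ≤
      ∑ j ∈ Finset.range m, 0.182 * (p * (1 - p)) *
        (|t| ^ 3 * Real.exp (-(p * (1 - p) * (j / 5 + (m - 1 - j) / 2)) * |t| ^ 2)) := by
  have hw : 0 < p * (1 - p) := mul_pos hp0 (by linarith)
  have h1 := norm_bernoulliChar_le hp0 hp1 ht
  have h2 := norm_bernoulliChar_sub_exp_le hp0 hp1 ht
  rw [← (Commute.all _ _).geom_sum₂_mul, norm_mul]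
  refine (mul_le_mul (norm_sum_le _ _) h2 (norm_nonneg _)
    (Finset.sum_nonneg fun _ _ => norm_nonneg _)).trans ?_
  rw [Finset.sum_mul]
  refine Finset.sum_le_sum fun j hj => ?_
  have hj' : j + 1 ≤ m := Finset.mem_range.1 hj
  have hcast : ((m - 1 - j : ℕ) : ℝ) = m - 1 - j := by
    rw [Nat.sub_sub, Nat.cast_sub (by omega)]
    push_cast
    ring
  rw [norm_mul, norm_pow, norm_pow, Complex.norm_real, Real.norm_of_nonneg (Real.exp_pos _).le]
  have h3 : ‖bernoulliChar p t‖ ^ j * Real.exp (-(p * (1 - p) * t ^ 2 / 2)) ^ (m - 1 - j) ≤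
      Real.exp (-(p * (1 - p) * (j / 5 + (m - 1 - j) / 2)) * |t| ^ 2) := by
    refine (mul_le_mul_of_nonneg_right (pow_le_pow_left₀ (norm_nonneg _) h1 j)
      (by positivity)).trans_eq ?_
    rw [← Real.exp_nat_mul, ← Real.exp_nat_mul, ← Real.exp_add, hcast, sq_abs]
    ring_nf
  refine (mul_le_mul_of_nonneg_right h3 (by positivity)).trans_eq ?_
  ring

theorem intervalIntegral_comp_abs_symm {F : ℝ → ℝ} (hF : Continuous F) {a : ℝ} (ha : 0 ≤ a) :
    ∫ t in (-a)..a, F |t| = 2 * ∫ t in (0 : ℝ)..a, F t := by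
  have hc : Continuous fun t : ℝ => F |t| := hF.comp continuous_abs
  rw [← intervalIntegral.integral_add_adjacent_intervals (b := 0)
    (hc.intervalIntegrable _ _) (hc.intervalIntegrable _ _)]
  have h1 : ∫ t in (-a)..0, F |t| = ∫ t in (0 : ℝ)..a, F |t| := by
    have := intervalIntegral.integral_comp_neg (a := 0) (b := a) (fun t => F |t|)
    simpa using this.symm
  have h2 : ∫ t in (0 : ℝ)..a, F |t| = ∫ t in (0 : ℝ)..a, F t :=
    intervalIntegral.integral_congr fun t ht => by
      rw [Set.uIcc_of_le ha] at ht
      simp [abs_of_nonneg ht.1]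
  rw [h1, h2]
  ring

theorem hasDerivAt_exp_neg_mul_sq (b t : ℝ) :
    HasDerivAt (fun t => Real.exp (-b * t ^ 2)) (-(2 * b * t) * Real.exp (-b * t ^ 2)) t := by
  refine (((hasDerivAt_id t).pow 2).const_mul (-b)).exp.congr_deriv ?_
  simp
  ring

theorem integral_abs_mul_exp_neg_mul_sq_le {a b : ℝ} (ha : 0 ≤ a) (hb : 0 < b) :
    ∫ t in (-a)..a, |t| * Real.exp (-b * |t| ^ 2) ≤ 1 / b := by
  have hF : Continuous fun t : ℝ => t * Real.exp (-b * t ^ 2) := by fun_prop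
  rw [intervalIntegral_comp_abs_symm hF ha]
  have hd : ∀ t : ℝ, HasDerivAt (fun t => -(1 / (2 * b)) * Real.exp (-b * t ^ 2))
      (t * Real.exp (-b * t ^ 2)) t := fun t =>
    ((hasDerivAt_exp_neg_mul_sq b t).const_mul _).congr_deriv (by field_simp)
  rw [intervalIntegral.integral_eq_sub_of_hasDerivAt (fun t _ => hd t)
    (hF.intervalIntegrable _ _)]
  have h0 : 0 ≤ 1 / b * Real.exp (-b * a ^ 2) := by positivity
  have h1 : 1 / (2 * b) = 1 / b / 2 := by field_simp
  simp only [h1, ne_eq, OfNat.ofNat_ne_zero, not_false_eq_true, zero_pow, mul_zero, Real.exp_zero]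
  linarith

theorem integral_abs_pow_three_mul_exp_neg_mul_sq_le {a b : ℝ} (ha : 0 ≤ a) (hb : 0 < b) :
    ∫ t in (-a)..a, |t| ^ 3 * Real.exp (-b * |t| ^ 2) ≤ 1 / b ^ 2 := by
  have hF : Continuous fun t : ℝ => t ^ 3 * Real.exp (-b * t ^ 2) := by fun_prop
  rw [intervalIntegral_comp_abs_symm hF ha]
  have hd : ∀ t : ℝ, HasDerivAt
      (fun t => -(1 / (2 * b ^ 2)) * ((b * t ^ 2 + 1) * Real.exp (-b * t ^ 2)))
      (t ^ 3 * Real.exp (-b * t ^ 2)) t := fun t => by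
    refine ((((((hasDerivAt_id t).pow 2).const_mul b).add_const 1).mul
      (hasDerivAt_exp_neg_mul_sq b t)).const_mul _).congr_deriv ?_
    simp
    field_simp
    ring
  rw [intervalIntegral.integral_eq_sub_of_hasDerivAt (fun t _ => hd t)
    (hF.intervalIntegrable _ _)]
  have h0 : 0 ≤ 1 / b ^ 2 * ((b * a ^ 2 + 1) * Real.exp (-b * a ^ 2)) := by positivity
  have h1 : 1 / (2 * b ^ 2) = 1 / b ^ 2 / 2 := by field_simp
  simp only [h1, ne_eq, OfNat.ofNat_ne_zero, not_false_eq_true, zero_pow, mul_zero, Real.exp_zero]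
  linarith

theorem integral_Ioi_exp_neg_mul_sq_le {a b : ℝ} (ha : 0 < a) (hb : 0 < b) :
    ∫ t in Set.Ioi a, Real.exp (-b * t ^ 2) ≤ 1 / (2 * b * a) := by
  have hi : MeasureTheory.Integrable fun t : ℝ => t * Real.exp (-b * t ^ 2) :=
    integrable_mul_exp_neg_mul_sq hb
  have hd : ∀ t : ℝ, HasDerivAt (fun t => -(1 / (2 * b)) * Real.exp (-b * t ^ 2))
      (t * Real.exp (-b * t ^ 2)) t := fun t =>
    ((hasDerivAt_exp_neg_mul_sq b t).const_mul _).congr_deriv (by field_simp)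
  have hlim : Filter.Tendsto (fun t : ℝ => -(1 / (2 * b)) * Real.exp (-b * t ^ 2)) Filter.atTop
      (nhds 0) := by
    have h1 : Filter.Tendsto (fun t : ℝ => -b * t ^ 2) Filter.atTop Filter.atBot :=
      (Filter.tendsto_pow_atTop two_ne_zero).const_mul_atTop_of_neg (by linarith)
    simpa using (Real.tendsto_exp_atBot.comp h1).const_mul (-(1 / (2 * b)))
  have hI := MeasureTheory.integral_Ioi_of_hasDerivAt_of_tendsto' (a := a) (fun t _ => hd t)
    hi.integrableOn hlim
  calc ∫ t in Set.Ioi a, Real.exp (-b * t ^ 2)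
      ≤ ∫ t in Set.Ioi a, 1 / a * (t * Real.exp (-b * t ^ 2)) := by
        refine MeasureTheory.setIntegral_mono_on (integrable_exp_neg_mul_sq hb).integrableOn
          (hi.const_mul _).integrableOn measurableSet_Ioi fun t ht => ?_
        rw [← mul_assoc]
        refine le_mul_of_one_le_left (Real.exp_pos _).le ?_
        rw [one_div, inv_mul_eq_div, one_le_div ha]
        exact (Set.mem_Ioi.1 ht).le
    _ = 1 / a * (1 / (2 * b) * Real.exp (-b * a ^ 2)) := by
        rw [MeasureTheory.integral_const_mul, hI]
        ring
    _ ≤ 1 / a * (1 / (2 * b) * 1) := by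
        gcongr
        exact Real.exp_le_one_iff.2 (by nlinarith [sq_nonneg a])
    _ = 1 / (2 * b * a) := by field_simp

open Complex in
theorem integral_cexp_int_mul_I (k : ℤ) :
    ∫ t in (-Real.pi)..Real.pi, cexp ((k * t : ℝ) * I) = if k = 0 then (2 * Real.pi : ℂ) else 0 := by
  split_ifs with hk
  · subst hk
    simp
    ring
  · have hc : (k : ℂ) * I ≠ 0 := mul_ne_zero (by exact_mod_cast hk) I_ne_zero
    have h1 : ∀ t : ℝ, cexp ((k * t : ℝ) * I) = cexp ((k : ℂ) * I * t) := fun t => by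
      push_cast
      ring_nf
    simp_rw [h1]
    rw [integral_exp_mul_complex hc, div_eq_zero_iff]
    left
    have h2 : (k : ℂ) * I * (Real.pi : ℝ) = (k : ℂ) * I * (-Real.pi : ℝ) + k * (2 * Real.pi * I) := by
      push_cast
      ring
    rw [h2, Complex.exp_add, exp_int_mul_two_pi_mul_I, mul_one, sub_self]

open Complex in
theorem integral_bernoulliChar_pow_mul_cexp (p : ℝ) (m j : ℕ) :
    ∫ t in (-Real.pi)..Real.pi, bernoulliChar p t ^ m * cexp (((m * p - j) * t : ℝ) * I) =
      2 * Real.pi * ((m.choose j * p ^ j * (1 - p) ^ (m - j) : ℝ) : ℂ) := by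
  have hexpand : ∀ t : ℝ, bernoulliChar p t ^ m * cexp (((m * p - j) * t : ℝ) * I) =
      ∑ i ∈ Finset.range (m + 1), ((m.choose i * p ^ i * (1 - p) ^ (m - i) : ℝ) : ℂ) *
        cexp (((i - j : ℤ) * t : ℝ) * I) := fun t => by
    have hfac : bernoulliChar p t = cexp ((-p * t : ℝ) * I) * (p * cexp (t * I) + (1 - p)) := by
      unfold bernoulliChar
      rw [mul_add, mul_left_comm _ (p : ℂ), ← Complex.exp_add]
      push_cast
      ring_nf
    rw [hfac, mul_pow, ← Complex.exp_nat_mul, add_pow, Finset.mul_sum, Finset.sum_mul]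
    refine Finset.sum_congr rfl fun i _ => ?_
    rw [mul_pow, ← Complex.exp_nat_mul]
    have hE : cexp ((((i : ℤ) - (j : ℤ) : ℤ) * t : ℝ) * I) =
        cexp (m * ((-p * t : ℝ) * I)) * cexp (i * (t * I)) * cexp (((m * p - j) * t : ℝ) * I) := by
      rw [← Complex.exp_add, ← Complex.exp_add]
      congr 1
      push_cast
      ring
    rw [hE]
    push_cast
    ring
  simp_rw [hexpand]
  rw [intervalIntegral.integral_finsetSum]
  swap
  · intro i _
    exact Continuous.intervalIntegrable (by fun_prop) _ _
  simp_rw [intervalIntegral.integral_const_mul, integral_cexp_int_mul_I]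
  by_cases hj : j ∈ Finset.range (m + 1)
  · rw [Finset.sum_eq_single_of_mem j hj fun i _ hij => by
      rw [if_neg (by omega), mul_zero]]
    simp
    ring
  · rw [Finset.sum_eq_zero fun i hi => ?_]
    · rw [Nat.choose_eq_zero_of_lt (by simpa using hj)]
      simp
    · rw [if_neg, mul_zero]
      intro h
      exact hj (by rwa [show j = i by omega])

open Complex in
theorem integral_exp_neg_mul_sq_mul_cexp {s : ℝ} (hs : 0 < s) (y : ℝ) :
    ∫ t : ℝ, ((Real.exp (-(s / 2) * t ^ 2) : ℝ) : ℂ) * cexp ((-y * t : ℝ) * I) =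
      2 * Real.pi * (((Real.sqrt (2 * Real.pi))⁻¹ * Real.exp (-y ^ 2 / (2 * s)) / Real.sqrt s : ℝ) : ℂ) := by
  have h := fourierIntegral_gaussian (b := ((s / 2 : ℝ) : ℂ)) (by simpa using hs) (-y)
  have hl : ∀ t : ℝ, ((Real.exp (-(s / 2) * t ^ 2) : ℝ) : ℂ) * cexp ((-y * t : ℝ) * I) =
      cexp (I * -y * t) * cexp (-((s / 2 : ℝ) : ℂ) * t ^ 2) := fun t => by
    rw [mul_comm]
    push_cast
    ring_nf
  simp_rw [hl]
  rw [h]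
  have hr : ((Real.pi : ℂ) / ((s / 2 : ℝ) : ℂ)) ^ (1 / 2 : ℂ) = (Real.sqrt (2 * Real.pi / s) : ℝ) := by
    rw [Real.sqrt_eq_rpow, ofReal_cpow (by positivity)]
    congr 1
    · push_cast
      field_simp
    · push_cast
      rfl
  rw [hr]
  have he : cexp (-(-(y : ℂ)) ^ 2 / (4 * ((s / 2 : ℝ) : ℂ))) = (Real.exp (-y ^ 2 / (2 * s)) : ℝ) := by
    push_cast
    congr 1
    rw [neg_sq]
    ring_nf
  rw [he]
  have hsq : Real.sqrt (2 * Real.pi / s) = 2 * Real.pi * (Real.sqrt (2 * Real.pi))⁻¹ / Real.sqrt s := by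
    rw [Real.sqrt_div (by positivity)]
    congr 1
    rw [← div_eq_mul_inv, Real.div_sqrt]
  rw [hsq]
  push_cast
  ring

open Complex in
theorem abs_binomial_sub_gaussian_le {p : ℝ} (hp0 : 0 < p) (hp1 : p ≤ 1 / 2) {m : ℕ} (hm : 2 ≤ m)
    {c y : ℝ} {j : ℕ} (hc : |c| ≤ 1 - p) (hj : c - y = m * p - j) :
    2 * Real.pi * |m.choose j * p ^ j * (1 - p) ^ (m - j) -
      (Real.sqrt (2 * Real.pi))⁻¹ * Real.exp (-y ^ 2 / (2 * ((m + 1) * p * (1 - p)))) /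
        Real.sqrt ((m + 1) * p * (1 - p))| ≤
      ∑ i ∈ Finset.range m, 0.182 * (p * (1 - p)) *
        (1 / (p * (1 - p) * (i / 5 + (m - 1 - i) / 2)) ^ 2) +
      (1 - p) * (1 / (m * (p * (1 - p)) / 2)) + 2 / ((m + 1) * p * (1 - p) * Real.pi) := by
  set w := p * (1 - p) with hw
  have hw0 : 0 < w := mul_pos hp0 (by linarith)
  have hm' : (2 : ℝ) ≤ m := by exact_mod_cast hm
  set s := (m + 1) * p * (1 - p) with hs
  have hsw : s = (m + 1) * w := by rw [hs, hw]; ring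
  have hs0 : 0 < s := by rw [hsw]; positivity
  have hpi := Real.pi_pos
  set G : ℝ → ℂ := fun t => ((Real.exp (-(s / 2) * t ^ 2) : ℝ) : ℂ) * cexp ((-y * t : ℝ) * I) with hG
  have hGn : ∀ t, ‖G t‖ = Real.exp (-(s / 2) * t ^ 2) := fun t => by
    rw [hG]
    simp only [norm_mul, norm_exp_ofReal_mul_I, mul_one, norm_real]
    exact Real.norm_of_nonneg (Real.exp_pos _).le
  have hGc : Continuous G := by fun_prop
  have hGi : MeasureTheory.Integrable G :=
    (integrable_exp_neg_mul_sq (half_pos hs0)).mono' hGc.aestronglyMeasurable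
      (Filter.Eventually.of_forall fun t => (hGn t).le)
  set H : ℝ → ℂ := fun t => bernoulliChar p t ^ m * cexp (((m * p - j) * t : ℝ) * I) with hH
  have hfc : Continuous (bernoulliChar p) := by unfold bernoulliChar; fun_prop
  have hHc : Continuous H := by fun_prop
  have hsplit : ∫ t, G t = (∫ t in Set.Iic (-Real.pi), G t) + (∫ t in (-Real.pi)..Real.pi, G t) +
      ∫ t in Set.Ioi Real.pi, G t := by
    rw [← intervalIntegral.integral_Iic_add_Ioi (b := Real.pi) hGi.integrableOn hGi.integrableOn,
      ← intervalIntegral.integral_Iic_sub_Iic (a := -Real.pi) hGi.integrableOn hGi.integrableOn]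
    ring
  have htail1 : ‖∫ t in Set.Ioi Real.pi, G t‖ ≤ 1 / (s * Real.pi) := by
    refine (MeasureTheory.norm_integral_le_integral_norm _).trans ?_
    simp_rw [hGn]
    refine (integral_Ioi_exp_neg_mul_sq_le hpi (half_pos hs0)).trans_eq ?_
    ring_nf
  have htail2 : ‖∫ t in Set.Iic (-Real.pi), G t‖ ≤ 1 / (s * Real.pi) := by
    refine (MeasureTheory.norm_integral_le_integral_norm _).trans ?_
    simp_rw [hGn]
    rw [← integral_comp_neg_Ioi Real.pi (fun t => Real.exp (-(s / 2) * t ^ 2))]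
    simp_rw [neg_sq]
    refine (integral_Ioi_exp_neg_mul_sq_le hpi (half_pos hs0)).trans_eq ?_
    ring_nf
  have hpoint : ∀ t, |t| ≤ Real.pi → ‖H t - G t‖ ≤
      (∑ i ∈ Finset.range m, 0.182 * w *
        (|t| ^ 3 * Real.exp (-(w * (i / 5 + (m - 1 - i) / 2)) * |t| ^ 2))) +
        (1 - p) * (|t| * Real.exp (-(m * w / 2) * |t| ^ 2)) := fun t ht => by
    set g := Real.exp (-(w * t ^ 2 / 2)) with hg
    have hgm : ((g : ℝ) : ℂ) ^ m = ((Real.exp (-(m * w / 2) * |t| ^ 2) : ℝ) : ℂ) := by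
      rw [hg, ← ofReal_pow, ← Real.exp_nat_mul, sq_abs]
      ring_nf
    have hdec : H t - G t = ((bernoulliChar p t ^ m - (g : ℂ) ^ m) * cexp ((c * t : ℝ) * I) +
        (g : ℂ) ^ m * (cexp ((c * t : ℝ) * I) - g)) * cexp ((-y * t : ℝ) * I) := by
      have h1 : cexp (((m * p - j) * t : ℝ) * I) = cexp ((c * t : ℝ) * I) * cexp ((-y * t : ℝ) * I) := by
        rw [← Complex.exp_add, ← hj]
        push_cast
        ring_nf
      have h2 : ((Real.exp (-(s / 2) * t ^ 2) : ℝ) : ℂ) = (g : ℂ) ^ m * g := by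
        rw [← pow_succ, ← ofReal_pow, hg, ← Real.exp_nat_mul, hsw]
        push_cast
        ring_nf
      simp only [hH, hG, h1, h2]
      ring
    rw [hdec, norm_mul, norm_exp_ofReal_mul_I, mul_one]
    refine (norm_add_le _ _).trans (add_le_add ?_ ?_)
    · rw [norm_mul, norm_exp_ofReal_mul_I, mul_one]
      exact norm_bernoulliChar_pow_sub_exp_le hp0 (by linarith) ht m
    · rw [norm_mul, hgm, norm_real, Real.norm_of_nonneg (Real.exp_pos _).le]
      have h3 : ‖cexp ((c * t : ℝ) * I) - g‖ ≤ |(1 - p) * t| := by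
        refine norm_cexp_ofReal_mul_I_sub_exp_neg_le (by positivity) ?_ ?_
        · rw [mul_pow, mul_pow]
          refine mul_le_mul_of_nonneg_right ?_ (sq_nonneg t)
          rw [← sq_abs c]
          exact pow_le_pow_left₀ (abs_nonneg _) hc 2
        · nlinarith [sq_nonneg t, mul_nonneg (sq_nonneg t)
            (mul_nonneg (by linarith : 0 ≤ 1 - p) (by linarith : 0 ≤ (1 - p) - p / 2))]
      rw [abs_mul, abs_of_nonneg (by linarith : 0 ≤ 1 - p)] at h3
      refine (mul_le_mul_of_nonneg_left h3 (Real.exp_pos _).le).trans_eq ?_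
      ring
  have hmain : ‖∫ t in (-Real.pi)..Real.pi, (H t - G t)‖ ≤
      ∑ i ∈ Finset.range m, 0.182 * w * (1 / (w * (i / 5 + (m - 1 - i) / 2)) ^ 2) +
      (1 - p) * (1 / (m * w / 2)) := by
    have hc1 : ∀ i ∈ Finset.range m, IntervalIntegrable (fun t : ℝ => 0.182 * w *
        (|t| ^ 3 * Real.exp (-(w * (i / 5 + (m - 1 - i) / 2)) * |t| ^ 2)))
        MeasureTheory.volume (-Real.pi) Real.pi := fun i _ =>
      Continuous.intervalIntegrable (by fun_prop) _ _
    refine (intervalIntegral.norm_integral_le_of_norm_le (by linarith)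
      (Filter.Eventually.of_forall fun t ht => hpoint t (abs_le.2 ⟨ht.1.le, ht.2⟩))
      (Continuous.intervalIntegrable (by fun_prop) _ _)).trans ?_
    rw [intervalIntegral.integral_add (Continuous.intervalIntegrable (by fun_prop) _ _)
      (Continuous.intervalIntegrable (by fun_prop) _ _), intervalIntegral.integral_finsetSum hc1]
    simp_rw [intervalIntegral.integral_const_mul]
    refine add_le_add (Finset.sum_le_sum fun i hi => ?_) ?_
    · have hi' : (i : ℝ) + 1 ≤ m := by exact_mod_cast Finset.mem_range.1 hi
      have hi0 : (0 : ℝ) ≤ i := Nat.cast_nonneg i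
      refine mul_le_mul_of_nonneg_left
        (integral_abs_pow_three_mul_exp_neg_mul_sq_le hpi.le (mul_pos hw0 ?_)) (by positivity)
      linarith
    · exact mul_le_mul_of_nonneg_left
        (integral_abs_mul_exp_neg_mul_sq_le hpi.le (by positivity)) (by linarith)
  have hid : ((2 * Real.pi * (m.choose j * p ^ j * (1 - p) ^ (m - j) -
      (Real.sqrt (2 * Real.pi))⁻¹ * Real.exp (-y ^ 2 / (2 * s)) / Real.sqrt s) : ℝ) : ℂ) =
      (∫ t in (-Real.pi)..Real.pi, (H t - G t)) - (∫ t in Set.Iic (-Real.pi), G t) -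
        ∫ t in Set.Ioi Real.pi, G t := by
    rw [intervalIntegral.integral_sub (hHc.intervalIntegrable _ _) (hGc.intervalIntegrable _ _)]
    have h1 := integral_bernoulliChar_pow_mul_cexp p m j
    have h2 := integral_exp_neg_mul_sq_mul_cexp hs0 y
    change ∫ t in (-Real.pi)..Real.pi, H t = _ at h1
    change ∫ t, G t = _ at h2
    rw [hsplit] at h2
    rw [mul_sub, ofReal_sub, ofReal_mul, ofReal_mul (2 * Real.pi)]
    push_cast at h1 h2 ⊢
    linear_combination -h1 + h2
  have hn : 2 * Real.pi * |m.choose j * p ^ j * (1 - p) ^ (m - j) -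
      (Real.sqrt (2 * Real.pi))⁻¹ * Real.exp (-y ^ 2 / (2 * s)) / Real.sqrt s| =
      ‖(∫ t in (-Real.pi)..Real.pi, (H t - G t)) - (∫ t in Set.Iic (-Real.pi), G t) -
        ∫ t in Set.Ioi Real.pi, G t‖ := by
    rw [← hid, norm_real, Real.norm_eq_abs, abs_mul, abs_of_pos (by positivity : 0 < 2 * Real.pi)]
  rw [hn]
  refine (norm_sub_le _ _).trans ((add_le_add (norm_sub_le _ _) le_rfl).trans ?_)
  have : 2 / (s * Real.pi) = 1 / (s * Real.pi) + 1 / (s * Real.pi) := by ring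
  linarith

theorem sum_inv_sq_le {m : ℕ} (hm : 4 ≤ m) :
    ∑ i ∈ Finset.range m, 1 / ((i : ℝ) / 5 + (m - 1 - i) / 2) ^ 2 ≤
      (10 * m / ((m - 0.7) * (m - 1.75)) : ℝ) := by
  have hm' : (4 : ℝ) ≤ m := by exact_mod_cast hm
  set A : ℕ → ℝ := fun i => 0.5 * m - 0.35 - 0.3 * i with hA
  have hterm : ∀ i ∈ Finset.range m, 1 / ((i : ℝ) / 5 + (m - 1 - i) / 2) ^ 2 ≤
      1 / 0.3 * (1 / A (i + 1)) - 1 / 0.3 * (1 / A i) := fun i hi => by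
    have hi' : (i : ℝ) + 1 ≤ m := by exact_mod_cast Finset.mem_range.1 hi
    have h1 : 0 < A (i + 1) := by
      simp only [hA]
      push_cast
      linarith
    have h2 : A i = A (i + 1) + 0.3 := by
      simp only [hA]
      push_cast
      ring
    have h3 : (i : ℝ) / 5 + (m - 1 - i) / 2 = A (i + 1) + 0.15 := by
      simp only [hA]
      push_cast
      ring
    have h4 : 1 / 0.3 * (1 / A (i + 1)) - 1 / 0.3 * (1 / (A (i + 1) + 0.3)) =
        1 / (A (i + 1) * (A (i + 1) + 0.3)) := by
      field_simp
      ring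
    rw [h2, h3, h4]
    refine one_div_le_one_div_of_le (by positivity) ?_
    nlinarith
  refine (Finset.sum_le_sum hterm).trans_eq ?_
  rw [Finset.sum_range_sub (fun i => 1 / 0.3 * (1 / A i))]
  have h1 : A m = 0.2 * (m - 1.75) := by simp only [hA]; ring
  have h2 : A 0 = 0.5 * (m - 0.7) := by simp only [hA]; push_cast; ring
  have h3 : (m : ℝ) - 1.75 ≠ 0 := by linarith
  have h4 : (m : ℝ) - 0.7 ≠ 0 := by linarith
  rw [h1, h2]
  field_simp
  ring

theorem variance_mul_abs_binomial_sub_gaussian_le {p : ℝ} (hp0 : 0 < p) (hp1 : p ≤ 1 / 2) {m : ℕ}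
    (hm : 4 ≤ m) {c y : ℝ} {j : ℕ} (hc : |c| ≤ 1 - p) (hj : c - y = m * p - j) :
    (m + 1) * p * (1 - p) * |m.choose j * p ^ j * (1 - p) ^ (m - j) -
      (Real.sqrt (2 * Real.pi))⁻¹ * Real.exp (-y ^ 2 / (2 * ((m + 1) * p * (1 - p)))) /
        Real.sqrt ((m + 1) * p * (1 - p))| ≤ 0.89 + 0.4 * (1 - p) := by
  have h := abs_binomial_sub_gaussian_le hp0 hp1 (by omega) hc hj
  set E := |m.choose j * p ^ j * (1 - p) ^ (m - j) -
      (Real.sqrt (2 * Real.pi))⁻¹ * Real.exp (-y ^ 2 / (2 * ((m + 1) * p * (1 - p)))) /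
        Real.sqrt ((m + 1) * p * (1 - p))|
  have hm' : (4 : ℝ) ≤ m := by exact_mod_cast hm
  have hq : 0 < 1 - p := by linarith
  have hE : 0 ≤ (m + 1) * p * (1 - p) * E := by positivity
  have h1 : ∑ i ∈ Finset.range m, 0.182 * (p * (1 - p)) *
        (1 / (p * (1 - p) * ((i : ℝ) / 5 + (m - 1 - i) / 2)) ^ 2) ≤
      0.182 / (p * (1 - p)) * (10 * m / ((m - 0.7) * (m - 1.75))) := by
    refine le_trans (le_of_eq ?_) (mul_le_mul_of_nonneg_left (sum_inv_sq_le hm) (by positivity))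
    rw [Finset.mul_sum]
    refine Finset.sum_congr rfl fun i _ => ?_
    rw [mul_pow]
    field_simp
  have h2 : (m + 1) * (10 * m / ((m - 0.7) * (m - 1.75))) ≤ (26.95 : ℝ) := by
    have : (0 : ℝ) < (m - 0.7) * (m - 1.75) := mul_pos (by linarith) (by linarith)
    rw [mul_div_assoc', div_le_iff₀ this]
    nlinarith
  have h3 : ((m : ℝ) + 1) / m ≤ 1.25 := by
    rw [div_le_iff₀ (by linarith)]
    linarith
  have h4 : 2 / Real.pi ≤ 0.64 := by
    rw [div_le_iff₀ Real.pi_pos]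
    linarith [Real.pi_gt_d4]
  have h5 := mul_le_mul_of_nonneg_left (h.trans (add_le_add (add_le_add h1 le_rfl) le_rfl))
    (by positivity : 0 ≤ (m + 1) * p * (1 - p))
  have h6 : (m + 1) * p * (1 - p) * (0.182 / (p * (1 - p)) * (10 * m / ((m - 0.7) * (m - 1.75))) +
      (1 - p) * (1 / (m * (p * (1 - p)) / 2)) + 2 / ((m + 1) * p * (1 - p) * Real.pi)) =
      0.182 * ((m + 1) * (10 * m / ((m - 0.7) * (m - 1.75)))) + 2 * (1 - p) * ((m + 1) / m)
        + 2 / Real.pi := by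
    have ha : (m : ℝ) - 0.7 ≠ 0 := by linarith
    have hb : (m : ℝ) - 1.75 ≠ 0 := by linarith
    have := Real.pi_pos
    field_simp
  rw [h6] at h5
  have h7 : (1 - p) * ((m + 1) / m) ≤ (1 - p) * 1.25 := mul_le_mul_of_nonneg_left h3 hq.le
  have h8 := mul_le_mul_of_nonneg_right Real.pi_gt_d4.le hE
  nlinarith

theorem inv_sqrt_two_pi_le : (Real.sqrt (2 * Real.pi))⁻¹ ≤ 0.4 := by
  rw [inv_le_comm₀ (Real.sqrt_pos.2 (by positivity)) (by norm_num)]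
  refine Real.le_sqrt_of_sq_le ?_
  linarith [Real.pi_gt_d4]

theorem gaussian_le (z : ℝ) : (Real.sqrt (2 * Real.pi))⁻¹ * Real.exp (-z ^ 2 / 2) ≤ 0.4 := by
  have h1 : Real.exp (-z ^ 2 / 2) ≤ 1 := Real.exp_le_one_iff.2 (by nlinarith [sq_nonneg z])
  have h2 : 0 ≤ (Real.sqrt (2 * Real.pi))⁻¹ := by positivity
  nlinarith [inv_sqrt_two_pi_le]

theorem gaussian_mul_abs_le (z : ℝ) :
    (Real.sqrt (2 * Real.pi))⁻¹ * Real.exp (-z ^ 2 / 2) * |z| ≤ 0.2428 := by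
  have h1 : Real.exp (-z ^ 2 / 2) * |z| ≤ 0.607 := by
    refine le_of_sq_le_sq ?_ (by norm_num)
    rw [mul_pow, sq_abs, ← Real.exp_nat_mul]
    have h2 : z ^ 2 ≤ Real.exp (z ^ 2 - 1) := by linarith [Real.add_one_le_exp (z ^ 2 - 1)]
    have h3 : Real.exp ((2 : ℕ) * (-z ^ 2 / 2)) * Real.exp (z ^ 2 - 1) * Real.exp 1 = 1 := by
      rw [← Real.exp_add, ← Real.exp_add, Real.exp_eq_one_iff]
      push_cast
      ring
    have h4 := mul_le_mul_of_nonneg_left h2 (Real.exp_pos ((2 : ℕ) * (-z ^ 2 / 2))).le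
    have h5 : 0 ≤ Real.exp ((2 : ℕ) * (-z ^ 2 / 2)) * Real.exp (z ^ 2 - 1) := by positivity
    nlinarith [Real.exp_one_gt_d9]
  have h2 : 0 ≤ (Real.sqrt (2 * Real.pi))⁻¹ := by positivity
  have h3 : 0 ≤ Real.exp (-z ^ 2 / 2) * |z| := by positivity
  rw [mul_assoc]
  nlinarith [inv_sqrt_two_pi_le]

theorem choose_mul_pow_mul_pow_le_one {p : ℝ} (hp0 : 0 ≤ p) (hp1 : p ≤ 1) (m j : ℕ) :
    (m.choose j : ℝ) * p ^ j * (1 - p) ^ (m - j) ≤ 1 := by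
  have hq : 0 ≤ 1 - p := by linarith
  rcases le_or_gt j m with hj | hj
  · have h := add_pow p (1 - p) m
    rw [add_sub_cancel, one_pow] at h
    exact le_trans (le_of_eq (by ring)) ((Finset.single_le_sum
      (f := fun i => p ^ i * (1 - p) ^ (m - i) * (m.choose i : ℝ))
      (fun i _ => by positivity) (Finset.mem_range.2 (Nat.lt_succ_of_le hj))).trans_eq h.symm)
  · simp [Nat.choose_eq_zero_of_lt hj]

theorem gaussian_term_nonneg {p : ℝ} (hp0 : 0 < p) (hp1 : p ≤ 1 / 2) {n k : ℝ} (hn : 0 < n)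
    (hk : 0 ≤ k) : 0 ≤ Real.sqrt (n * p * (1 - p)) +
      (k - n * p) / Real.sqrt (n * p * (1 - p)) * (1 - 2 * p) / 2 := by
  have hs : 0 < n * p * (1 - p) := mul_pos (mul_pos hn hp0) (by linarith)
  have hσ := Real.sqrt_pos.2 hs
  have hσ2 := Real.sq_sqrt hs.le
  have : Real.sqrt (n * p * (1 - p)) +
      (k - n * p) / Real.sqrt (n * p * (1 - p)) * (1 - 2 * p) / 2 =
      (Real.sqrt (n * p * (1 - p)) ^ 2 + (k - n * p) * (1 - 2 * p) / 2) /
        Real.sqrt (n * p * (1 - p)) := by field_simp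
  rw [this, hσ2]
  refine div_nonneg ?_ hσ.le
  nlinarith [mul_pos hn hp0, mul_nonneg hk (by linarith : 0 ≤ 1 - 2 * p)]

theorem strictAntiOn_L : StrictAntiOn L (Set.Ioc 0 (1 / 2)) := by
  set M : ℝ → ℝ := fun x => (0.516 + 0.121 * x) / (x * (1 - 2 * x + 2 * x ^ 2)) +
    0.271 * ((1 - 2 * x) * (1 + 2 * x - 2 * x ^ 2) / (1 - 2 * x + 2 * x ^ 2) ^ 2) with hM
  have he : ∀ x : ℝ, 1 / 2 ≤ 1 - 2 * x + 2 * x ^ 2 := fun x => by nlinarith [sq_nonneg (2 * x - 1)]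
  have hLM : ∀ x ∈ Set.Ioc (0 : ℝ) (1 / 2), L x = (Real.sqrt (x * (1 - x)))⁻¹ * M x := by
    intro x hx
    have h0 := hx.1
    have h1 : 0 < Real.sqrt (x * (1 - x)) :=
      Real.sqrt_pos.2 (mul_pos hx.1 (by linarith [hx.2]))
    have h2 : 1 - 2 * x * (1 - x) = 1 - 2 * x + 2 * x ^ 2 := by ring
    have h3 : 1 + 2 * x * (1 - x) = 1 + 2 * x - 2 * x ^ 2 := by ring
    have h4 : 0 < 1 - 2 * x + 2 * x ^ 2 := by linarith [he x]
    simp only [L, hM]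
    rw [h2, h3]
    field_simp
  have hMpos : ∀ x ∈ Set.Ioc (0 : ℝ) (1 / 2), 0 < M x := by
    intro x hx
    have h0 := hx.1
    have h1 := hx.2
    have h4 : 0 < 1 - 2 * x + 2 * x ^ 2 := by linarith [he x]
    have h5 : 0 ≤ (1 - 2 * x) * (1 + 2 * x - 2 * x ^ 2) :=
      mul_nonneg (by linarith) (by nlinarith)
    simp only [hM]
    positivity
  have hMd : ∀ x ∈ Set.Ioc (0 : ℝ) (1 / 2), HasDerivAt M
      ((0.121 * (x * (1 - 2 * x + 2 * x ^ 2)) - (0.516 + 0.121 * x) * (1 - 4 * x + 6 * x ^ 2)) /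
        (x * (1 - 2 * x + 2 * x ^ 2)) ^ 2 +
      0.271 * ((-2 * (1 - 2 * x + 2 * x ^ 2) ^ 2 + 14 * (1 - 2 * x + 2 * x ^ 2) - 8) /
        (1 - 2 * x + 2 * x ^ 2) ^ 3)) x := by
    intro x hx
    have h0 := hx.1
    have h4 : 0 < 1 - 2 * x + 2 * x ^ 2 := by linarith [he x]
    have d0 : HasDerivAt (fun x : ℝ => 1 - 2 * x + 2 * x ^ 2) (-2 + 4 * x) x := by
      convert! (((hasDerivAt_id x).const_mul 2).const_sub 1).add
        (((hasDerivAt_id x).pow 2).const_mul 2) using 1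
      simp
      ring
    have d1 : HasDerivAt (fun x : ℝ => 0.516 + 0.121 * x) 0.121 x := by
      convert! ((hasDerivAt_id x).const_mul (0.121 : ℝ)).const_add 0.516 using 1
      ring
    have d2 : HasDerivAt (fun x : ℝ => (1 - 2 * x) * (1 + 2 * x - 2 * x ^ 2))
        (-2 * (1 + 2 * x - 2 * x ^ 2) + (1 - 2 * x) * (2 - 4 * x)) x := by
      convert! (((hasDerivAt_id x).const_mul 2).const_sub 1).mul
        ((((hasDerivAt_id x).const_mul 2).const_add 1).sub
        (((hasDerivAt_id x).pow 2).const_mul 2)) using 1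
      simp [-mul_eq_mul_left_iff]
      ring
    convert! (d1.div ((hasDerivAt_id x).mul d0) (mul_ne_zero h0.ne' h4.ne')).add
      ((d2.div (d0.pow 2) (pow_ne_zero 2 h4.ne')).const_mul 0.271) using 1
    simp
    field_simp
    ring
  have hManti : StrictAntiOn M (Set.Ioc 0 (1 / 2)) := by
    refine strictAntiOn_of_deriv_neg (convex_Ioc 0 (1 / 2))
      (fun x hx => (hMd x hx).continuousAt.continuousWithinAt) fun x hx => ?_
    rw [interior_Ioc] at hx
    rw [(hMd x ⟨hx.1, hx.2.le⟩).deriv]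
    have h0 := hx.1
    have h1 := hx.2
    have h4 := he x
    set e := 1 - 2 * x + 2 * x ^ 2 with he'
    have h5 : 0 < x * e := by positivity
    have h6 : x * e ≤ 1 / 4 := by
      rw [he']
      nlinarith [mul_nonneg h0.le (sq_nonneg (2 * x - 1)), sq_nonneg (2 * x - 1)]
    have h7 : (0.121 * (x * e) - (0.516 + 0.121 * x) * (1 - 4 * x + 6 * x ^ 2)) / (x * e) ^ 2 ≤
        -2.2 := by
      have h8 : (1 / 3 : ℝ) ≤ 1 - 4 * x + 6 * x ^ 2 := by nlinarith [sq_nonneg (3 * x - 1)]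
      rw [div_le_iff₀ (by positivity)]
      nlinarith [mul_nonneg h0.le (by linarith : 0 ≤ 1 - 4 * x + 6 * x ^ 2)]
    have h9 : (-2 * e ^ 2 + 14 * e - 8) / e ^ 3 ≤ 5 := by
      rw [div_le_iff₀ (by positivity)]
      nlinarith [mul_nonneg (by linarith : 0 ≤ e) (sq_nonneg (e - 0.85)), sq_nonneg (e - 0.85)]
    linarith
  intro a ha b hb hab
  rw [hLM a ha, hLM b hb]
  have hsq : Real.sqrt (a * (1 - a)) ≤ Real.sqrt (b * (1 - b)) :=
    Real.sqrt_le_sqrt (by nlinarith [ha.1, hb.2])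
  have hsa : 0 < Real.sqrt (a * (1 - a)) :=
    Real.sqrt_pos.2 (mul_pos ha.1 (by linarith [ha.2]))
  calc (Real.sqrt (b * (1 - b)))⁻¹ * M b ≤ (Real.sqrt (a * (1 - a)))⁻¹ * M b :=
        mul_le_mul_of_nonneg_right (inv_anti₀ hsa hsq) (hMpos b hb).le
    _ < (Real.sqrt (a * (1 - a)))⁻¹ * M a :=
        mul_lt_mul_of_pos_left (hManti ha hb hab) (inv_pos.2 hsa)

theorem integrable_exp_neg_sq_div_two :
    MeasureTheory.Integrable fun t : ℝ => Real.exp (-t ^ 2 / 2) := by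
  convert! integrable_exp_neg_mul_sq (by norm_num : (0 : ℝ) < 1 / 2) using 3
  ring

theorem hasDerivAt_Phi (x : ℝ) :
    HasDerivAt Phi ((Real.sqrt (2 * Real.pi))⁻¹ * Real.exp (-x ^ 2 / 2)) x := by
  have hcont : Continuous fun t : ℝ => Real.exp (-t ^ 2 / 2) := by fun_prop
  have hPhi : Phi = fun y => (Real.sqrt (2 * Real.pi))⁻¹ *
      ((∫ t in (0 : ℝ)..y, Real.exp (-t ^ 2 / 2)) +
        ∫ t in Set.Iic (0 : ℝ), Real.exp (-t ^ 2 / 2)) := by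
    funext y
    rw [Phi, ← intervalIntegral.integral_Iic_sub_Iic
      integrable_exp_neg_sq_div_two.integrableOn integrable_exp_neg_sq_div_two.integrableOn,
      sub_add_cancel, MeasureTheory.integral_Iic_eq_integral_Iio]
  rw [hPhi]
  exact ((hcont.integral_hasStrictDerivAt 0 x).hasDerivAt.add_const _).const_mul _

theorem Phi_nonneg (x : ℝ) : 0 ≤ Phi x :=
  mul_nonneg (by positivity) (MeasureTheory.integral_nonneg fun _ => (Real.exp_pos _).le)

theorem Phi_le_one (x : ℝ) : Phi x ≤ 1 := by
  have h : ∫ t : ℝ, Real.exp (-t ^ 2 / 2) = Real.sqrt (2 * Real.pi) := by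
    rw [show 2 * Real.pi = Real.pi / (1 / 2) by ring, ← integral_gaussian]
    congr 1 with t
    ring_nf
  have h2 : 0 < Real.sqrt (2 * Real.pi) := Real.sqrt_pos.2 (by positivity)
  rw [Phi, inv_mul_le_iff₀ h2, mul_one, ← h]
  exact MeasureTheory.setIntegral_le_integral integrable_exp_neg_sq_div_two
    (Filter.Eventually.of_forall fun _ => (Real.exp_pos _).le)

theorem binomCDF_natCast {n K : ℕ} (hK : K ≤ n + 1) (p : ℝ) :
    binomCDF n p K = ∑ i ∈ Finset.range K, (n.choose i : ℝ) * p ^ i * (1 - p) ^ (n - i) := by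
  rw [binomCDF, ← Finset.sum_filter]
  congr 1
  ext i
  simp only [Finset.mem_filter, Finset.mem_range, Nat.cast_lt]
  omega

theorem binomCDF_nonneg {n : ℕ} {p : ℝ} (hp0 : 0 ≤ p) (hp1 : p ≤ 1) (x : ℝ) :
    0 ≤ binomCDF n p x := by
  have hq : 0 ≤ 1 - p := by linarith
  refine Finset.sum_nonneg fun i _ => ?_
  split_ifs
  · positivity
  · rfl

theorem binomCDF_le_one {n : ℕ} {p : ℝ} (hp0 : 0 ≤ p) (hp1 : p ≤ 1) (x : ℝ) :
    binomCDF n p x ≤ 1 := by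
  have hq : 0 ≤ 1 - p := by linarith
  have h := add_pow p (1 - p) n
  rw [add_sub_cancel, one_pow] at h
  refine le_trans (Finset.sum_le_sum fun i _ => ?_) h.symm.le
  split_ifs
  · exact le_of_eq (by ring)
  · positivity

theorem hasDerivAt_binomCDF_natCast_succ {n K : ℕ} (hK : K ≤ n) (p : ℝ) :
    HasDerivAt (fun x => binomCDF n x (K + 1 : ℕ))
      (-(n * ((n - 1).choose K * p ^ K * (1 - p) ^ (n - 1 - K)))) p := by
  have hev : ∀ (m i : ℕ) (x : ℝ), (bernsteinPolynomial ℝ m i).eval x =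
      (m.choose i : ℝ) * x ^ i * (1 - x) ^ (m - i) := fun m i x => by
    simp [bernsteinPolynomial]
  have hpoly : ∀ K : ℕ, (∑ i ∈ Finset.range (K + 1), bernsteinPolynomial ℝ n i).derivative =
      -(n * bernsteinPolynomial ℝ (n - 1) K) := fun K => by
    induction K with
    | zero => simp [bernsteinPolynomial.derivative_zero]
    | succ K ih =>
      rw [Finset.sum_range_succ, Polynomial.derivative_add, ih,
        bernsteinPolynomial.derivative_succ]
      ring
  have h := (∑ i ∈ Finset.range (K + 1), bernsteinPolynomial ℝ n i).hasDerivAt p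
  rw [hpoly] at h
  convert! h using 1
  · funext x
    rw [binomCDF_natCast (by omega), Polynomial.eval_finsetSum]
    exact Finset.sum_congr rfl fun i _ => (hev n i x).symm
  · simp [hev]

theorem hasDerivAt_standardization {n p : ℝ} (k : ℝ) (hn : 0 < n) (hp0 : 0 < p) (hp1 : p ≤ 1 / 2) :
    HasDerivAt (fun x => (k - n * x) / Real.sqrt (n * x * (1 - x)))
      (-(Real.sqrt (n * p * (1 - p)) +
        (k - n * p) / Real.sqrt (n * p * (1 - p)) * (1 - 2 * p) / 2) / (p * (1 - p))) p := by
  have hq : 0 < 1 - p := by linarith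
  have hs : 0 < n * p * (1 - p) := by positivity
  have hσ := Real.sqrt_pos.2 hs
  have d1 : HasDerivAt (fun x => k - n * x) (-n) p := by
    convert! ((hasDerivAt_id p).const_mul n).const_sub k using 1
    ring
  have d2 : HasDerivAt (fun x => n * x * (1 - x)) (n * (1 - 2 * p)) p := by
    convert! ((hasDerivAt_id p).const_mul n).mul ((hasDerivAt_id p).const_sub 1) using 1
    simp
    ring
  convert! d1.div (d2.sqrt hs.ne') hσ.ne' using 1
  have hσ2 := Real.sq_sqrt hs.le
  have hpq : p * (1 - p) = Real.sqrt (n * p * (1 - p)) ^ 2 / n := by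
    rw [hσ2]
    field_simp
  rw [hpq]
  field_simp
  ring

theorem hasDerivAt_binomCDF_sub_Gnp {n k K : ℕ} (hn : 0 < n) {p b : ℝ} (hp0 : 0 < p)
    (hp1 : p ≤ 1 / 2) (hb : HasDerivAt (fun x => binomCDF n x K) (-(n * b)) p) :
    HasDerivAt (fun x => binomCDF n x K - Gnp n x k)
      (-(n * p * (1 - p) * b - (Real.sqrt (2 * Real.pi))⁻¹ *
        Real.exp (-((k - n * p) / Real.sqrt (n * p * (1 - p))) ^ 2 / 2) *
        (Real.sqrt (n * p * (1 - p)) +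
          (k - n * p) / Real.sqrt (n * p * (1 - p)) * (1 - 2 * p) / 2)) / (p * (1 - p))) p := by
  have hq : 0 < 1 - p := by linarith
  have hn' : (0 : ℝ) < n := by exact_mod_cast hn
  convert! hb.sub ((hasDerivAt_Phi _).comp p
    (hasDerivAt_standardization (k : ℝ) hn' hp0 hp1)) using 1
  field_simp
  ring

theorem abs_gaussian_correction_le (z : ℝ) {t : ℝ} (ht : 0 ≤ t) :
    |(Real.sqrt (2 * Real.pi))⁻¹ * Real.exp (-z ^ 2 / 2) * (z * t / 2)| ≤ 0.1214 * t := by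
  have h : |(Real.sqrt (2 * Real.pi))⁻¹ * Real.exp (-z ^ 2 / 2) * (z * t / 2)| =
      (Real.sqrt (2 * Real.pi))⁻¹ * Real.exp (-z ^ 2 / 2) * |z| * (t / 2) := by
    rw [abs_mul, abs_of_nonneg (a := (Real.sqrt (2 * Real.pi))⁻¹ * _) (by positivity), abs_div,
      abs_mul, abs_of_nonneg ht, abs_two]
    ring
  rw [h]
  nlinarith [gaussian_mul_abs_le z]

theorem abs_derivative_numerator_le {n k j : ℕ} (hn : 1 ≤ n) (hj : k = j + 1 ∨ k = j) {p : ℝ}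
    (hp0 : 0 < p) (hp1 : p ≤ 1 / 2) :
    |n * p * (1 - p) * ((n - 1).choose j * p ^ j * (1 - p) ^ (n - 1 - j)) -
      (Real.sqrt (2 * Real.pi))⁻¹ *
        Real.exp (-((k - n * p) / Real.sqrt (n * p * (1 - p))) ^ 2 / 2) *
        (Real.sqrt (n * p * (1 - p)) +
          (k - n * p) / Real.sqrt (n * p * (1 - p)) * (1 - 2 * p) / 2)| +
      0.687 * (1 - 2 * p) ≤ 0.516 / p + 0.121 := by
  obtain ⟨m, rfl⟩ : ∃ m, n = m + 1 := ⟨n - 1, by omega⟩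
  rw [Nat.add_sub_cancel]
  have hq : 0 < 1 - p := by linarith
  have hs : 0 < ((m + 1 : ℕ) : ℝ) * p * (1 - p) := by positivity
  have hT0 := gaussian_term_nonneg hp0 hp1 (n := ((m + 1 : ℕ) : ℝ)) (by positivity)
    (Nat.cast_nonneg' k)
  have hb0 : 0 ≤ (m.choose j : ℝ) * p ^ j * (1 - p) ^ (m - j) := by positivity
  have hb1 := choose_mul_pow_mul_pow_le_one hp0.le (by linarith : p ≤ 1) m j
  have hcor := abs_gaussian_correction_le
    ((k - (m + 1 : ℕ) * p) / Real.sqrt ((m + 1 : ℕ) * p * (1 - p)))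
    (by linarith : 0 ≤ 1 - 2 * p)
  have hφ := gaussian_le ((k - (m + 1 : ℕ) * p) / Real.sqrt ((m + 1 : ℕ) * p * (1 - p)))
  set σ := Real.sqrt ((m + 1 : ℕ) * p * (1 - p)) with hσdef
  have hσ : 0 < σ := Real.sqrt_pos.2 hs
  have hσ2 : σ ^ 2 = (m + 1 : ℕ) * p * (1 - p) := Real.sq_sqrt hs.le
  set z := (k - (m + 1 : ℕ) * p) / σ with hz
  set φ := (Real.sqrt (2 * Real.pi))⁻¹ * Real.exp (-z ^ 2 / 2) with hφdef
  have hφ0 : 0 ≤ φ := by positivity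
  rcases le_or_gt 4 m with hm | hm
  · have hc : ∃ c : ℝ, |c| ≤ 1 - p ∧ c - (k - (m + 1) * p) = m * p - j := by
      rcases hj with rfl | rfl
      · exact ⟨1 - p, (abs_of_pos hq).le, by push_cast; ring⟩
      · exact ⟨-p, by rw [abs_neg, abs_of_pos hp0]; linarith, by ring⟩
    obtain ⟨c, hc, hcj⟩ := hc
    have h := variance_mul_abs_binomial_sub_gaussian_le hp0 hp1 hm hc hcj
    have hexp : -((k : ℝ) - (m + 1) * p) ^ 2 / (2 * ((m + 1) * p * (1 - p))) = -z ^ 2 / 2 := by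
      rw [hz, div_pow, hσ2]
      push_cast
      field_simp
    have hσ' : Real.sqrt (((m : ℝ) + 1) * p * (1 - p)) = σ := by rw [hσdef]; push_cast; rfl
    have hs' : ((m : ℝ) + 1) * p * (1 - p) = σ ^ 2 := by rw [hσ2]; push_cast; rfl
    rw [hexp, hσ', hs', ← hφdef, ← abs_of_nonneg (sq_nonneg σ), ← abs_mul] at h
    have hW : (m + 1 : ℕ) * p * (1 - p) * (m.choose j * p ^ j * (1 - p) ^ (m - j)) -
        φ * (σ + z * (1 - 2 * p) / 2) =
        σ ^ 2 * (m.choose j * p ^ j * (1 - p) ^ (m - j) - φ / σ) -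
          φ * (z * (1 - 2 * p) / 2) := by
      rw [← hσ2]
      field_simp
      ring
    rw [hW]
    have h2 := abs_sub (σ ^ 2 * (m.choose j * p ^ j * (1 - p) ^ (m - j) - φ / σ))
      (φ * (z * (1 - 2 * p) / 2))
    have h3 : 0.769 + 0.4 * (1 - p) + 0.8084 * (1 - 2 * p) ≤ 0.516 / p := by
      rw [le_div_iff₀ hp0]
      nlinarith [sq_nonneg (p - 0.49)]
    linarith
  · have hm' : (m : ℝ) ≤ 3 := by exact_mod_cast Nat.lt_succ_iff.1 hm
    have hs1 : ((m + 1 : ℕ) : ℝ) * p * (1 - p) ≤ 1 := by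
      push_cast
      nlinarith [mul_pos hp0 hq, sq_nonneg (2 * p - 1)]
    have hσ1 : σ ≤ 1 := by nlinarith
    have hsb : (m + 1 : ℕ) * p * (1 - p) * (m.choose j * p ^ j * (1 - p) ^ (m - j)) ≤ (1 : ℝ) :=
      mul_le_one₀ hs1 hb0 hb1
    have hsb0 : 0 ≤ (m + 1 : ℕ) * p * (1 - p) * (m.choose j * p ^ j * (1 - p) ^ (m - j)) :=
      mul_nonneg hs.le hb0
    have hT : φ * (σ + z * (1 - 2 * p) / 2) ≤ 1 := by
      have h1 := (le_abs_self _).trans hcor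
      have h2 : φ * σ ≤ 0.4 * 1 := mul_le_mul hφ hσ1 hσ.le (by norm_num)
      rw [mul_add]
      linarith
    have hT' := mul_nonneg hφ0 hT0
    have hW : |(m + 1 : ℕ) * p * (1 - p) * (m.choose j * p ^ j * (1 - p) ^ (m - j)) -
        φ * (σ + z * (1 - 2 * p) / 2)| ≤ 1 := abs_sub_le_iff.2 ⟨by linarith, by linarith⟩
    have h3 : 0.879 + 0.687 * (1 - 2 * p) ≤ 0.516 / p := by
      rw [le_div_iff₀ hp0]
      nlinarith [sq_nonneg (p - 0.57)]
    linarith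

theorem abs_derivative_numerator_zero_le {n : ℕ} (hn : 1 ≤ n) {p : ℝ}
    (hp0 : 0 < p) (hp1 : p ≤ 1 / 2) :
    |n * p * (1 - p) * 0 - (Real.sqrt (2 * Real.pi))⁻¹ *
        Real.exp (-(((0 : ℕ) - n * p) / Real.sqrt (n * p * (1 - p))) ^ 2 / 2) *
        (Real.sqrt (n * p * (1 - p)) +
          ((0 : ℕ) - n * p) / Real.sqrt (n * p * (1 - p)) * (1 - 2 * p) / 2)| +
      0.687 * (1 - 2 * p) ≤ 0.516 / p + 0.121 := by
  have hq : 0 < 1 - p := by linarith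
  have hn' : (0 : ℝ) < n := by exact_mod_cast hn
  have hs : 0 < (n : ℝ) * p * (1 - p) := by positivity
  have hT0 := gaussian_term_nonneg hp0 hp1 hn' (Nat.cast_nonneg' 0)
  have hg := gaussian_mul_abs_le (((0 : ℕ) - n * p) / Real.sqrt (n * p * (1 - p)))
  set σ := Real.sqrt (n * p * (1 - p))
  have hσ : 0 < σ := Real.sqrt_pos.2 hs
  have hσ2 : σ ^ 2 = n * p * (1 - p) := Real.sq_sqrt hs.le
  have hz0 : ((0 : ℕ) - n * p) / σ ≤ 0 :=
    div_nonpos_of_nonpos_of_nonneg (by push_cast; nlinarith) hσ.le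
  have hσz : σ = (1 - p) * |((0 : ℕ) - n * p) / σ| := by
    rw [abs_of_nonpos hz0]
    field_simp
    rw [hσ2]
    push_cast
    ring
  set z := ((0 : ℕ) - n * p) / σ
  set φ := (Real.sqrt (2 * Real.pi))⁻¹ * Real.exp (-z ^ 2 / 2)
  have hφ0 : 0 ≤ φ := by positivity
  have hT : φ * (σ + z * (1 - 2 * p) / 2) ≤ 0.2428 * (1 - p) := by
    calc φ * (σ + z * (1 - 2 * p) / 2) ≤ φ * σ :=
          mul_le_mul_of_nonneg_left (by nlinarith) hφ0
      _ = φ * |z| * (1 - p) := by conv_lhs => rw [hσz]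
                                  ring
      _ ≤ 0.2428 * (1 - p) := mul_le_mul_of_nonneg_right hg hq.le
  rw [mul_zero, zero_sub, abs_neg, abs_of_nonneg (mul_nonneg hφ0 hT0)]
  have h3 : 0.2428 + 0.687 * (1 - 2 * p) ≤ 0.516 / p := by
    rw [le_div_iff₀ hp0]
    nlinarith [sq_nonneg (p - 0.4)]
  nlinarith

theorem exists_hasDerivAt_binomCDF {n k K : ℕ} (hn : 1 ≤ n) (hk : k ≤ n)
    (hK : K = k ∨ K = k + 1) {p : ℝ} (hp0 : 0 < p) (hp1 : p ≤ 1 / 2) :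
    ∃ b : ℝ, HasDerivAt (fun x => binomCDF n x K) (-(n * b)) p ∧
      |n * p * (1 - p) * b - (Real.sqrt (2 * Real.pi))⁻¹ *
        Real.exp (-((k - n * p) / Real.sqrt (n * p * (1 - p))) ^ 2 / 2) *
        (Real.sqrt (n * p * (1 - p)) +
          (k - n * p) / Real.sqrt (n * p * (1 - p)) * (1 - 2 * p) / 2)| +
      0.687 * (1 - 2 * p) ≤ 0.516 / p + 0.121 := by
  rcases K with _ | j
  · obtain rfl : k = 0 := by omega
    refine ⟨0, ?_, abs_derivative_numerator_zero_le hn hp0 hp1⟩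
    simp only [binomCDF_natCast (Nat.zero_le _), Finset.range_zero, Finset.sum_empty, mul_zero,
      neg_zero]
    exact hasDerivAt_const p (0 : ℝ)
  · rcases Nat.lt_or_ge n (j + 1) with hj | hj
    · exact ⟨_, hasDerivAt_binomCDF_natCast_succ (by omega) p,
        abs_derivative_numerator_le hn (by omega) hp0 hp1⟩
    · exact ⟨_, hasDerivAt_binomCDF_natCast_succ (by omega) p,
        abs_derivative_numerator_le hn (by omega) hp0 hp1⟩

theorem abs_binomCDF_sub_Gnp_le_one {n : ℕ} {p : ℝ} (hp0 : 0 ≤ p) (hp1 : p ≤ 1) (x y : ℝ) :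
    |binomCDF n p x - Gnp n p y| ≤ 1 :=
  abs_sub_le_iff.2
    ⟨by linarith [binomCDF_le_one (n := n) hp0 hp1 x,
        Phi_nonneg ((y - n * p) / Real.sqrt (n * p * (1 - p))),
        show Gnp n p y = Phi ((y - n * p) / Real.sqrt (n * p * (1 - p))) from rfl],
      by linarith [binomCDF_nonneg (n := n) hp0 hp1 x,
        Phi_le_one ((y - n * p) / Real.sqrt (n * p * (1 - p))),
        show Gnp n p y = Phi ((y - n * p) / Real.sqrt (n * p * (1 - p))) from rfl]⟩

theorem rho_pos {p : ℝ} (hp0 : 0 < p) (hp1 : p ≤ 1 / 2) : 0 < rho p :=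
  div_pos (by positivity) (Real.sqrt_pos.2 (mul_pos hp0 (by linarith)))

theorem hasDerivAt_div_rho {f : ℝ → ℝ} {W p : ℝ} (hp0 : 0 < p) (hp1 : p ≤ 1 / 2)
    (hf : HasDerivAt f (-W / (p * (1 - p))) p) :
    HasDerivAt (fun x => f x / rho x)
      ((1 / ((1 - 2 * p * (1 - p)) * Real.sqrt (p * (1 - p)))) *
        (-W + f p * ((1 - 2 * p) * (1 + 2 * p * (1 - p)) / (1 - 2 * p * (1 - p))) / 2)) p := by
  have hq : 0 < 1 - p := by linarith
  have hw : 0 < p * (1 - p) := by positivity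
  have he : ∀ x : ℝ, 0 < 1 - 2 * x * (1 - x) := fun x => by nlinarith [sq_nonneg (2 * x - 1)]
  have hinv : (fun x => f x / rho x) =
      fun x => f x * (Real.sqrt (x * (1 - x)) / (1 - 2 * x * (1 - x))) := by
    funext x
    rw [rho, div_div_eq_mul_div, mul_div_assoc,
      show x ^ 2 + (1 - x) ^ 2 = 1 - 2 * x * (1 - x) by ring]
  have d1 : HasDerivAt (fun x : ℝ => x * (1 - x)) (1 - 2 * p) p := by
    convert! (hasDerivAt_id p).mul ((hasDerivAt_id p).const_sub 1) using 1
    simp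
    ring
  have d2 : HasDerivAt (fun x : ℝ => 1 - 2 * x * (1 - x)) (-2 * (1 - 2 * p)) p := by
    convert! (d1.const_mul 2).const_sub 1 using 1
    · funext x
      ring
    · ring
  rw [hinv]
  convert! hf.mul ((d1.sqrt hw.ne').div d2 (he p).ne') using 1
  rw [Pi.div_apply]
  have hσ := Real.sqrt_pos.2 hw
  have hσ2 := Real.sq_sqrt hw.le
  have hep := (he p).ne'
  set σ := Real.sqrt (p * (1 - p))
  have h1 : 1 - 2 * p * (1 - p) = 1 - 2 * σ ^ 2 := by rw [hσ2]; ring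
  have h2 : 1 + 2 * p * (1 - p) = 1 + 2 * σ ^ 2 := by rw [hσ2]; ring
  rw [h1] at hep
  rw [h1, h2, ← hσ2]
  field_simp
  ring

theorem abs_binomCDF_sub_Gnp_div_rho_sub_le {n k K : ℕ} (hn : 1 ≤ n) (hk : k ≤ n)
    (hK : K = k ∨ K = k + 1) {a b : ℝ} (ha : 0 < a) (hab : a ≤ b) (hb : b ≤ 1 / 2) :
    |(binomCDF n b K - Gnp n b k) / rho b - (binomCDF n a K - Gnp n a k) / rho a| ≤
      L a * (b - a) := by
  have hderiv : ∀ p ∈ Set.Icc a b, ∃ d : ℝ,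
      HasDerivAt (fun x => (binomCDF n x K - Gnp n x k) / rho x) d p ∧ |d| ≤ L a := by
    intro p hp
    have hp0 := ha.trans_le hp.1
    have hp1 := hp.2.trans hb
    have hw : 0 < p * (1 - p) := mul_pos hp0 (by linarith)
    obtain ⟨β, hβ, hW⟩ := exists_hasDerivAt_binomCDF hn hk hK hp0 hp1
    refine ⟨_, hasDerivAt_div_rho hp0 hp1 (hasDerivAt_binomCDF_sub_Gnp hn hp0 hp1 hβ), ?_⟩
    refine le_trans ?_ (strictAntiOn_L.antitoneOn ⟨ha, hp.1.trans hp1⟩ ⟨hp0, hp1⟩ hp.1)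
    set W := n * p * (1 - p) * β - (Real.sqrt (2 * Real.pi))⁻¹ *
        Real.exp (-((k - n * p) / Real.sqrt (n * p * (1 - p))) ^ 2 / 2) *
        (Real.sqrt (n * p * (1 - p)) +
          (k - n * p) / Real.sqrt (n * p * (1 - p)) * (1 - 2 * p) / 2)
    have hu := abs_binomCDF_sub_Gnp_le_one (n := n) hp0.le (by linarith : p ≤ 1) K k
    have he : 0 < 1 - 2 * p * (1 - p) := by nlinarith [sq_nonneg (2 * p - 1)]
    set X := (1 - 2 * p) * (1 + 2 * p * (1 - p)) / (1 - 2 * p * (1 - p)) with hX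
    have hX0 : 0 ≤ X := div_nonneg (mul_nonneg (by linarith) (by nlinarith)) he.le
    have hX1 : X ≤ 3 * (1 - 2 * p) := by
      rw [hX, div_le_iff₀ he]
      have : 1 + 2 * p * (1 - p) ≤ 3 * (1 - 2 * p * (1 - p)) := by
        nlinarith [sq_nonneg (2 * p - 1)]
      nlinarith [mul_le_mul_of_nonneg_left this (by linarith : 0 ≤ 1 - 2 * p)]
    have hc : 0 ≤ 1 / ((1 - 2 * p * (1 - p)) * Real.sqrt (p * (1 - p))) := by positivity
    rw [L, abs_mul, abs_of_nonneg hc]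
    refine mul_le_mul_of_nonneg_left ?_ hc
    have h1 := abs_add_le (-W) ((binomCDF n p K - Gnp n p k) * X / 2)
    have h2 : |(binomCDF n p K - Gnp n p k) * X / 2| ≤ X / 2 := by
      rw [abs_div, abs_mul, abs_of_nonneg hX0, abs_two]
      nlinarith
    rw [abs_neg] at h1
    linarith
  choose! d hd hdL using hderiv
  have h := Convex.norm_image_sub_le_of_norm_hasDerivWithin_le
    (fun x hx => (hd x hx).hasDerivWithinAt) hdL (convex_Icc a b)
    (Set.left_mem_Icc.2 hab) (Set.right_mem_Icc.2 hab)
  rwa [Real.norm_eq_abs, Real.norm_of_nonneg (by linarith : 0 ≤ b - a)] at h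

theorem abs_Deltank_div_rho_sub_le {n k : ℕ} (hn : 1 ≤ n) (hk : k ≤ n) {a b : ℝ} (ha : 0 < a)
    (hab : a ≤ b) (hb : b ≤ 1 / 2) :
    |Deltank n k b / rho b - Deltank n k a / rho a| ≤ L a * (b - a) := by
  have hmax : ∀ x : ℝ, 0 < x → x ≤ 1 / 2 → Deltank n k x / rho x =
      max |(binomCDF n x k - Gnp n x k) / rho x|
        |(binomCDF n x (k + 1 : ℕ) - Gnp n x k) / rho x| := fun x hx0 hx1 => by
    have h := rho_pos hx0 hx1
    rw [abs_div, abs_div, abs_of_pos h, max_div_div_right h.le, Deltank]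
    push_cast
    rfl
  rw [hmax b (ha.trans_le hab) hb, hmax a ha (hab.trans hb)]
  refine (abs_max_sub_max_le_max _ _ _ _).trans (max_le ?_ ?_)
  · exact (abs_abs_sub_abs_le _ _).trans
      (abs_binomCDF_sub_Gnp_div_rho_sub_le hn hk (Or.inl rfl) ha hab hb)
  · exact (abs_abs_sub_abs_le _ _).trans
      (abs_binomCDF_sub_Gnp_div_rho_sub_le hn hk (Or.inr rfl) ha hab hb)

/-- For `0 < p₁ < p < p₂ ≤ 0.5`, all `n ≥ 1` and `0 ≤ k ≤ n`:
`|Δ_{n,k}(p)/ρ(p) − Δ_{n,k}(p₁)/ρ(p₁)| ≤ L(p₁)(p − p₁)` and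
`|Δ_{n,k}(p)/ρ(p) − Δ_{n,k}(p₂)/ρ(p₂)| < L(p₁)(p₂ − p)`. -/
theorem Deltank_over_rho_lipschitz (p₁ p p₂ : ℝ)
    (h₁ : 0 < p₁) (h₂ : p₁ < p) (h₃ : p < p₂) (h₄ : p₂ ≤ 0.5)
    (n k : ℕ) (hn : 1 ≤ n) (hk : k ≤ n) :
    |Deltank n k p / rho p - Deltank n k p₁ / rho p₁| ≤ L p₁ * (p - p₁) ∧
    |Deltank n k p / rho p - Deltank n k p₂ / rho p₂| < L p₁ * (p₂ - p) := by
  have h₄' : p₂ ≤ 1 / 2 := by linarith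
  have hp : 0 < p := h₁.trans h₂
  refine ⟨abs_Deltank_div_rho_sub_le hn hk h₁ h₂.le (by linarith), ?_⟩
  rw [abs_sub_comm]
  exact (abs_Deltank_div_rho_sub_le hn hk hp h₃.le h₄').trans_lt
    (mul_lt_mul_of_pos_right
      (strictAntiOn_L ⟨h₁, by linarith⟩ ⟨hp, by linarith⟩ h₂) (by linarith))
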